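/- arXiv:2303.10028 — 2 statements merged into one kernel-verified Lean document; each statement's English description precedes it below -/
import Mathlib

section
/- Let s_1,…,s_k (k ≥ 1) be closed line segments in ℝ² and let P = {p_{k+1},…,p_n} be a nonempty finite set of points in ℝ². Let δ* be the least δ ≥ 0 for which there exist points p_i ∈ s_i (i = 1,…,k) such that the graph G_δ({p_1,…,p_n}) is connected. Let T be a Euclidean minimum spanning tree of P, let δ ≥ 0, and let ℓ be the number of connected components of the graph obtained from T by deleting all edges of length greater than δ. If ℓ > 4k + 1, then δ < δ*. -/
open scoped NNReal

noncomputable section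

/-- The Euclidean plane. -/
abbrev Pl : Type := EuclideanSpace ℝ (Fin 2)

/-- The graph `G_δ(Q)`: vertices are the points of `Q`, two distinct points being adjacent
iff their Euclidean distance is at most `δ`; `ConnAt Q δ` says this graph is connected. -/
def ConnAt (Q : Set Pl) (δ : ℝ) : Prop :=
  (SimpleGraph.fromRel fun x y : Q => dist (x : Pl) (y : Pl) ≤ δ).Connected

/-- Euclidean length of an edge of the complete graph on the point set `P`, as a real number. -/
def edgeDist (P : Finset Pl) : Sym2 {x // x ∈ P} → ℝ :=
  Sym2.lift ⟨fun x y => dist (x : Pl) (y : Pl), fun _ _ => dist_comm _ _⟩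

/-- Total Euclidean edge length of a spanning subgraph `T` of the complete graph `K_P`. -/
def totalWeight (P : Finset Pl) (T : SimpleGraph {x // x ∈ P}) : ℝ≥0 :=
  ∑ e ∈ (Set.toFinite T.edgeSet).toFinset,
    Sym2.lift ⟨fun (x y : {x // x ∈ P}) => nndist (x : Pl) (y : Pl),
      fun _ _ => nndist_comm _ _⟩ e

/-- Two complex numbers of norm at most `r` whose arguments differ by at most `π / 3`
are at distance at most `r`. -/
lemma norm_sub_le_of_abs_arg_sub_le {z w : ℂ} {r : ℝ} (hz : ‖z‖ ≤ r) (hw : ‖w‖ ≤ r)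
    (h : |z.arg - w.arg| ≤ Real.pi / 3) : ‖z - w‖ ≤ r := by
  have hr : 0 ≤ r := (norm_nonneg z).trans hz
  have hcos : 1 / 2 ≤ Real.cos (z.arg - w.arg) := by
    rw [← Real.cos_abs, ← Real.cos_pi_div_three]
    exact Real.cos_le_cos_of_nonneg_of_le_pi (abs_nonneg _) (by linarith [Real.pi_pos]) h
  rw [Real.cos_sub] at hcos
  have hsq : ‖z - w‖ ^ 2 = ‖z‖ ^ 2 + ‖w‖ ^ 2 - 2 * (‖z‖ * ‖w‖ *
      (Real.cos z.arg * Real.cos w.arg + Real.sin z.arg * Real.sin w.arg)) := by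
    have h1 : ‖z‖ * Real.cos z.arg = z.re := Complex.norm_mul_cos_arg z
    have h2 : ‖z‖ * Real.sin z.arg = z.im := Complex.norm_mul_sin_arg z
    have h3 : ‖w‖ * Real.cos w.arg = w.re := Complex.norm_mul_cos_arg w
    have h4 : ‖w‖ * Real.sin w.arg = w.im := Complex.norm_mul_sin_arg w
    have h5 : ‖z‖ * ‖w‖ *
      (Real.cos z.arg * Real.cos w.arg + Real.sin z.arg * Real.sin w.arg)
        = z.re * w.re + z.im * w.im := by
      rw [← h1, ← h2, ← h3, ← h4]; ring
    rw [h5]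
    simp only [Complex.sq_norm, Complex.normSq_apply, Complex.sub_re, Complex.sub_im]
    ring
  have hzw : 0 ≤ ‖z‖ * ‖w‖ := by positivity
  refine abs_le_of_sq_le_sq' ?_ hr |>.2
  rw [hsq]
  have h6 := mul_le_mul_of_nonneg_left hcos hzw
  rcases le_total ‖z‖ ‖w‖ with hle | hle
  · nlinarith [mul_nonneg (norm_nonneg z) (sub_nonneg.2 hle), norm_nonneg w]
  · nlinarith [mul_nonneg (norm_nonneg w) (sub_nonneg.2 hle), norm_nonneg z]

/-- Among six points of a disk of radius `r` centred at the origin, the first one being on the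
nonnegative real axis, two are at distance at most `r`. -/
lemma exists_ne_norm_sub_le_of_arg_eq_zero {z : Fin 6 → ℂ} {r : ℝ} (hz : ∀ i, ‖z i‖ ≤ r)
    (h0 : (z 0).arg = 0) : ∃ i j, i ≠ j ∧ ‖z i - z j‖ ≤ r := by
  by_contra! hcon
  have hsep : ∀ i j, i ≠ j → Real.pi / 3 < |(z i).arg - (z j).arg| := by
    intro i j hij
    by_contra! h
    exact (hcon i j hij).not_ge (norm_sub_le_of_abs_arg_sub_le (hz i) (hz j) h)
  have hpi := Real.pi_pos
  let sector : Fin 5 → Fin 4 := fun i =>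
    if (z i.succ).arg ≤ -(2 * Real.pi / 3) then 0
    else if (z i.succ).arg ≤ 0 then 1
    else if (z i.succ).arg ≤ 2 * Real.pi / 3 then 2 else 3
  obtain ⟨i, j, hij, hs⟩ := Fintype.exists_ne_map_eq_of_card_lt sector (by simp)
  have hij' := hsep i.succ j.succ (by simpa using hij)
  have hi := hsep i.succ 0 (Fin.succ_ne_zero i)
  have hj := hsep j.succ 0 (Fin.succ_ne_zero j)
  rw [h0, sub_zero] at hi hj
  have hi1 := Complex.neg_pi_lt_arg (z i.succ)
  have hi2 := Complex.arg_le_pi (z i.succ)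
  have hj1 := Complex.neg_pi_lt_arg (z j.succ)
  have hj2 := Complex.arg_le_pi (z j.succ)
  simp only [sector] at hs
  rw [lt_abs] at hij' hi hj
  split_ifs at hs <;> first
    | exact absurd hs (by decide)
    | (rcases hij' with h | h <;> rcases hi with hi | hi <;> rcases hj with hj | hj <;> linarith)

/-- Among six points of a disk of radius `r` in the plane, two are at distance at most `r`. -/
lemma exists_ne_dist_le_of_dist_le {x : Fin 6 → Pl} {q : Pl} {r : ℝ}
    (hx : ∀ i, dist (x i) q ≤ r) : ∃ i j, i ≠ j ∧ dist (x i) (x j) ≤ r := by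
  let e := Complex.orthonormalBasisOneI.repr
  let u : Fin 6 → ℂ := fun i => e.symm (x i - q)
  have hnorm : ∀ i, ‖u i‖ ≤ r := fun i => by
    simpa only [u, LinearIsometryEquiv.norm_map, dist_eq_norm] using hx i
  let c : ℂ := Complex.exp (-((u 0).arg : ℂ) * Complex.I)
  have hc : ‖c‖ = 1 := by
    simpa [c] using Complex.norm_exp_ofReal_mul_I (-(u 0).arg)
  have harg : (u 0 * c).arg = 0 := by
    have : u 0 * c = (‖u 0‖ : ℂ) := by
      conv_lhs => rw [← Complex.norm_mul_exp_arg_mul_I (u 0)]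
      rw [mul_assoc, ← Complex.exp_add]
      simp
    rw [this]
    exact Complex.arg_ofReal_of_nonneg (norm_nonneg _)
  obtain ⟨i, j, hij, h⟩ := exists_ne_norm_sub_le_of_arg_eq_zero (z := fun i => u i * c) (r := r)
    (fun i => by simpa [hc] using hnorm i) harg
  refine ⟨i, j, hij, ?_⟩
  rw [← sub_mul, norm_mul, hc, mul_one] at h
  simpa [u, ← map_sub, dist_eq_norm] using h

/-- If `f` is constant along `δ`-close pairs of `Q`, then after adding one point to `Q` there is
such a labelling whose number of labels is smaller by at most four. -/
lemma exists_labelling_insert {Q : Finset Pl} {δ : ℝ} (hδ : 0 ≤ δ) (q : Pl)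
    {f : Pl → ℕ}
    (hf : ∀ x ∈ Q, ∀ y ∈ Q, dist x y ≤ δ → f x = f y) :
    ∃ g : Pl → ℕ, (∀ x ∈ insert q Q, ∀ y ∈ insert q Q, dist x y ≤ δ → g x = g y) ∧
      (Q.image f).card ≤ ((insert q Q).image g).card + 4 := by
  classical
  let N : Finset ℕ := {x ∈ Q | dist x q ≤ δ}.image f
  have hN : N.card ≤ 5 := by
    by_contra! h
    obtain ⟨M, hMN, hM⟩ := Finset.exists_subset_card_eq (show 6 ≤ N.card from h)
    let e := (Finset.equivFinOfCardEq hM).symm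
    have hrep : ∀ i : Fin 6, ∃ x ∈ Q, dist x q ≤ δ ∧ f x = e i := fun i => by
      simpa [N, and_assoc] using hMN (e i).2
    choose x hxQ hxq hxf using hrep
    obtain ⟨i, j, hij, hd⟩ := exists_ne_dist_le_of_dist_le hxq
    refine hij (e.injective (Subtype.ext ?_))
    rw [← hxf, ← hxf]
    exact hf _ (hxQ i) _ (hxQ j) hd
  obtain ⟨a, ha⟩ := Infinite.exists_notMem_finset (Q.image f)
  let g : Pl → ℕ := fun x => if x = q ∨ f x ∈ N then a else f x
  have hclose : ∀ y ∈ Q, dist y q ≤ δ → g y = a := fun y hy hyq =>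
    if_pos (Or.inr (Finset.mem_image_of_mem f (by simp [hy, hyq])))
  have hgq : g q = a := if_pos (Or.inl rfl)
  refine ⟨g, ?_, ?_⟩
  · intro x hx y hy hxy
    rcases Finset.mem_insert.1 hx with rfl | hx' <;>
      rcases Finset.mem_insert.1 hy with rfl | hy'
    · rfl
    · rw [hgq, hclose y hy' (by rwa [dist_comm])]
    · rw [hgq, hclose x hx' hxy]
    · by_cases hxq : x = q
      · subst hxq
        rw [hgq, hclose y hy' (by rwa [dist_comm])]
      · by_cases hyq : y = q
        · subst hyq
          rw [hgq, hclose x hx' hxy]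
        · simp only [g, hxq, hyq, false_or, hf x hx' y hy' hxy]
  · have hsub : insert a (Q.image f \ N) ⊆ (insert q Q).image g := by
      intro b hb
      rw [Finset.mem_insert, Finset.mem_sdiff] at hb
      by_cases hba : b = a
      · exact Finset.mem_image.2 ⟨q, Finset.mem_insert_self _ _, hgq.trans hba.symm⟩
      · obtain ⟨hb, hbN⟩ := hb.resolve_left hba
        obtain ⟨x, hx, rfl⟩ := Finset.mem_image.1 hb
        by_cases hxq : x = q
        · exact absurd (Finset.mem_image_of_mem f (by simp [hxq ▸ hx, hxq, hδ])) hbN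
        · exact Finset.mem_image.2 ⟨x, Finset.mem_insert_of_mem hx, if_neg (by tauto)⟩
    have h1 := Finset.card_le_card hsub
    rw [Finset.card_insert_of_notMem (fun h => ha (Finset.mem_sdiff.1 h).1)] at h1
    have h2 := Finset.le_card_sdiff N (Q.image f)
    omega

/-- Adding the points of `R` to `Q` decreases the number of labels of a labelling constant along
`δ`-close pairs by at most four per added point. -/
lemma exists_labelling_union {Q : Finset Pl} {δ : ℝ} (hδ : 0 ≤ δ) {f : Pl → ℕ}
    (hf : ∀ x ∈ Q, ∀ y ∈ Q, dist x y ≤ δ → f x = f y) (R : Finset Pl) :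
    ∃ g : Pl → ℕ, (∀ x ∈ R ∪ Q, ∀ y ∈ R ∪ Q, dist x y ≤ δ → g x = g y) ∧
      (Q.image f).card ≤ ((R ∪ Q).image g).card + 4 * R.card := by
  classical
  induction R using Finset.induction_on with
  | empty => exact ⟨f, by simpa using hf, by simp⟩
  | insert q R hq ih =>
    obtain ⟨g, hg, hcard⟩ := ih
    obtain ⟨g', hg', hcard'⟩ := exists_labelling_insert hδ q hg
    refine ⟨g', by rwa [Finset.insert_union], ?_⟩
    rw [Finset.insert_union, Finset.card_insert_of_notMem hq]
    omega

/-- If the graph `G_δ(Q)` is connected, a labelling constant along `δ`-close pairs is constant. -/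
lemma ConnAt.labelling_eq {Q : Set Pl} {δ : ℝ} (h : ConnAt Q δ) {α : Type*} {g : Pl → α}
    (hg : ∀ x ∈ Q, ∀ y ∈ Q, dist x y ≤ δ → g x = g y) {x y : Pl} (hx : x ∈ Q) (hy : y ∈ Q) :
    g x = g y := by
  obtain ⟨p⟩ := h.preconnected ⟨x, hx⟩ ⟨y, hy⟩
  suffices ∀ (a b : Q), (SimpleGraph.fromRel fun x y : Q => dist (x : Pl) (y : Pl) ≤ δ).Walk a b →
      g a = g b from this _ _ p
  intro a b p
  induction p with
  | nil => rfl
  | cons hadj _ ih =>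
    refine Eq.trans ?_ ih
    rw [SimpleGraph.fromRel_adj] at hadj
    refine hg _ (Subtype.prop _) _ (Subtype.prop _) ?_
    rcases hadj.2 with h | h
    · exact h
    · rwa [dist_comm]

/-- Exchange property of minimum spanning trees: two vertices joined by an edge of weight at most
`δ` are joined in the tree by a path whose edges have weight at most `δ`. -/
lemma SimpleGraph.IsTree.reachable_deleteEdges_of_le {V : Type*} [Finite V] {T : SimpleGraph V}
    (hT : T.IsTree) {w : Sym2 V → ℝ≥0}
    (hmin : ∀ T' : SimpleGraph V, T'.IsTree → ∑ e ∈ (Set.toFinite T.edgeSet).toFinset, w e ≤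
      ∑ e ∈ (Set.toFinite T'.edgeSet).toFinset, w e)
    {u v : V} {δ : ℝ≥0} (huv : w s(u, v) ≤ δ) :
    (T.deleteEdges {e | δ < w e}).Reachable u v := by
  classical
  by_contra hcon
  obtain ⟨p, hp⟩ := hT.connected.exists_isPath u v
  obtain ⟨e, hep, hel⟩ : ∃ e ∈ p.edges, δ < w e := by
    by_contra! h
    exact hcon ⟨p.toDeleteEdges _ fun e he => not_lt.2 (h e he)⟩
  have heT : e ∈ T.edgeSet := p.edges_subset_edgeSet hep
  have hle : T.deleteEdges {e} ≤ T := T.deleteEdges_le {e}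
  have hnreach : ¬ (T.deleteEdges {e}).Reachable u v := by
    intro h
    obtain ⟨r, hr⟩ := h.exists_isPath
    have := (hT.existsUnique_path u v).unique hp (hr.mapLe hle)
    rw [this, SimpleGraph.Walk.edges_mapLe_eq_edges] at hep
    simpa using r.edges_subset_edgeSet hep
  have hne : u ≠ v := fun h => hcon (h ▸ SimpleGraph.Reachable.rfl)
  have hnadj : s(u, v) ∉ (T.deleteEdges {e}).edgeSet := fun h =>
    hnreach (SimpleGraph.Adj.reachable h)
  have hacyc : (T.deleteEdges {e} ⊔ SimpleGraph.edge u v).IsAcyclic :=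
    (hT.isAcyclic.anti hle).sup_edge_of_not_reachable hnreach
  have hset : (T.deleteEdges {e} ⊔ SimpleGraph.edge u v).edgeSet =
      insert s(u, v) (T.edgeSet \ {e}) := by
    rw [SimpleGraph.edgeSet_sup, SimpleGraph.edgeSet_edge_of_ne hne,
      SimpleGraph.edgeSet_deleteEdges, Set.union_singleton]
  rw [SimpleGraph.edgeSet_deleteEdges] at hnadj
  have htree : (T.deleteEdges {e} ⊔ SimpleGraph.edge u v).IsTree := by
    have := hT.connected.nonempty
    obtain ⟨F, hF, -, hFT⟩ :=
      SimpleGraph.connected_top.exists_isTree_le_of_le_of_isAcyclic le_top hacyc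
    have hcard : F.edgeSet.ncard = T.edgeSet.ncard := by
      have h1 := (SimpleGraph.isTree_iff_connected_and_card.1 hFT).2
      have h2 := (SimpleGraph.isTree_iff_connected_and_card.1 hT).2
      rw [Nat.card_coe_set_eq] at h1 h2
      omega
    have hEq := Set.eq_of_subset_of_ncard_le (SimpleGraph.edgeSet_mono hF) (by
      rw [hcard, hset, Set.ncard_insert_of_notMem hnadj, Set.ncard_sdiff_singleton_add_one heT])
    rwa [SimpleGraph.edgeSet_inj.1 hEq]
  have hmin' := hmin _ htree
  have hfin : (Set.toFinite (T.deleteEdges {e} ⊔ SimpleGraph.edge u v).edgeSet).toFinset =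
      insert s(u, v) ((Set.toFinite T.edgeSet).toFinset.erase e) := by
    ext x
    simp [hset, and_comm]
  rw [hfin, Finset.sum_insert (by simpa [and_comm] using hnadj),
    ← Finset.add_sum_erase _ w ((Set.Finite.mem_toFinset _).2 heT)] at hmin'
  exact (huv.trans_lt hel).not_ge (le_of_add_le_add_right hmin')

/-- Let `δ*` be the least `δ ≥ 0` admitting points `pᵢ ∈ sᵢ` making `G_δ({p₁,…,pₙ})`
connected, let `T` be a Euclidean MST of `P`, and let `ℓ` be the number of connected
components of `T` after deleting all edges of length greater than `δ`.  If `ℓ > 4k + 1`,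
then `δ < δ*`. -/
theorem stmt5 (k : ℕ) (hk : 1 ≤ k) (s : Fin k → Set Pl)
    (hseg : ∀ i, ∃ a b : Pl, s i = segment ℝ a b)
    (P : Finset Pl) (hP : P.Nonempty)
    (δstar : ℝ)
    (hδstar : IsLeast {δ : ℝ | 0 ≤ δ ∧ ∃ p : Fin k → Pl, (∀ i, p i ∈ s i) ∧
        ConnAt (Set.range p ∪ ↑P) δ} δstar)
    (T : SimpleGraph {x // x ∈ P}) (hT : T.IsTree)
    (hMST : ∀ T' : SimpleGraph {x // x ∈ P}, T'.IsTree → totalWeight P T ≤ totalWeight P T')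
    (δ : ℝ) (hδ : 0 ≤ δ)
    (ℓ : ℕ)
    (hℓ : ℓ = Nat.card (T.deleteEdges {e | δ < edgeDist P e}).ConnectedComponent)
    (hbig : 4 * k + 1 < ℓ) :
    δ < δstar := by
  classical
  by_contra! hle
  obtain ⟨⟨-, p, -, hconn⟩, -⟩ := hδstar
  set D := T.deleteEdges {e | δ < edgeDist P e} with hD
  have hreach : ∀ u v : {x // x ∈ P}, dist (u : Pl) v ≤ δ → D.Reachable u v := by
    intro u v huv
    lift δ to ℝ≥0 using hδ
    let w : Sym2 {x // x ∈ P} → ℝ≥0 := Sym2.lift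
      ⟨fun (x y : {x // x ∈ P}) => nndist (x : Pl) (y : Pl), fun _ _ => nndist_comm _ _⟩
    have huv' : w s(u, v) ≤ δ := huv
    have hset : {e | (δ : ℝ) < edgeDist P e} = {e | δ < w e} := by
      ext e
      induction e using Sym2.ind with
      | _ x y => simp [w, edgeDist, ← NNReal.coe_lt_coe]
    rw [hD, hset]
    exact hT.reachable_deleteEdges_of_le hMST huv'
  obtain ⟨code, hcode⟩ := exists_injective_nat D.ConnectedComponent
  let f : Pl → ℕ := fun x =>
    if hx : x ∈ P then code (D.connectedComponentMk ⟨x, hx⟩) else 0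
  have hf : ∀ x ∈ P, ∀ y ∈ P, dist x y ≤ δ → f x = f y := by
    intro x hx y hy hxy
    simp only [f, hx, hy, dif_pos]
    rw [SimpleGraph.ConnectedComponent.sound (hreach ⟨x, hx⟩ ⟨y, hy⟩ hxy)]
  have hcardf : ℓ ≤ (P.image f).card := by
    rw [hℓ, ← Nat.card_range_of_injective hcode, Nat.card_coe_set_eq,
      ← Set.ncard_coe_finset]
    refine Set.ncard_le_ncard ?_ (Finset.finite_toSet _)
    rintro _ ⟨c, rfl⟩
    induction c using SimpleGraph.ConnectedComponent.ind with
    | _ v => exact Finset.mem_coe.2 (Finset.mem_image.2 ⟨v, v.2, by simp [f]⟩)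
  obtain ⟨g, hg, hcard⟩ := exists_labelling_union hδ hf (Finset.univ.image p)
  have hk' : (Finset.univ.image p).card ≤ k := by
    simpa using Finset.card_image_le (s := Finset.univ) (f := p)
  have hone : ((Finset.univ.image p ∪ P).image g).card ≤ 1 := by
    have hQ (x : Pl) : x ∈ Finset.univ.image p ∪ P ↔ x ∈ Set.range p ∪ ↑P := by simp
    rw [Finset.card_le_one]
    intro a ha b hb
    obtain ⟨x, hx, rfl⟩ := Finset.mem_image.1 ha
    obtain ⟨y, hy, rfl⟩ := Finset.mem_image.1 hb
    exact hconn.labelling_eq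
      (fun x hx y hy hxy => hg x ((hQ x).2 hx) y ((hQ y).2 hy) (hxy.trans hle))
      ((hQ x).1 hx) ((hQ y).1 hy)
  omega

end
end

section
/- Let s_1,…,s_k (k ≥ 1) be closed line segments in ℝ², let P = {p_{k+1},…,p_n} be a nonempty finite set of points in ℝ², and let δ* be the least δ ≥ 0 for which there exist points p_i ∈ s_i (i = 1,…,k) such that G_δ({p_1,…,p_n}) is connected. Fix δ ≥ 0, let T be a Euclidean minimum spanning tree of P, let 𝒞 = {C_1,…,C_ℓ} be the vertex sets of the connected components of T after deleting all edges of length greater than δ, and let 𝒮 = {s_1,…,s_k}. Then there exists a δ-realizable topology tree on the nodes 𝒮 ∪ 𝒞 if and only if δ ≥ δ*. -/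
open scoped NNReal

noncomputable section

/-- A topology tree on the nodes `𝒮 ∪ 𝒞` (segments indexed by `Fin k`, components by
`Fin ℓ`): a tree in which every segment node has degree at most 5 and no two component
nodes are adjacent. -/
def IsTopologyTree {k ℓ : ℕ} (τ : SimpleGraph (Fin k ⊕ Fin ℓ)) : Prop :=
  τ.IsTree ∧ (∀ i : Fin k, (τ.neighborSet (Sum.inl i)).ncard ≤ 5) ∧
    ∀ i j : Fin ℓ, ¬ τ.Adj (Sum.inr i) (Sum.inr j)

/-- A topology tree `τ` is `δ`-realizable: there are points `p j ∈ s j` such that adjacent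
segment nodes carry points at distance at most `δ`, and for every edge between a component
node `C i` and a segment node `s j` some point of `C i` is at distance at most `δ` from `p j`. -/
def Realizable {k ℓ : ℕ} (s : Fin k → Set Pl) (C : Fin ℓ → Set Pl) (δ : ℝ)
    (τ : SimpleGraph (Fin k ⊕ Fin ℓ)) : Prop :=
  ∃ p : Fin k → Pl, (∀ i, p i ∈ s i) ∧
    (∀ i j : Fin k, τ.Adj (Sum.inl i) (Sum.inl j) → dist (p i) (p j) ≤ δ) ∧
    (∀ (i : Fin ℓ) (j : Fin k), τ.Adj (Sum.inr i) (Sum.inl j) →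
      ∃ q ∈ C i, dist q (p j) ≤ δ)

/-- Six directions in the plane cannot make pairwise angles greater than `π / 3`. -/
lemma exists_half_le_cos_sub (φ : Fin 6 → ℝ) :
    ∃ i j, i ≠ j ∧ 1 / 2 ≤ Real.cos (φ i - φ j) := by
  by_contra! h
  have hπ := Real.pi_pos
  choose n hn using fun i => existsUnique_add_zsmul_mem_Ico Real.two_pi_pos (φ i - φ 0) 0
  set ψ : Fin 6 → ℝ := fun i => φ i - φ 0 + n i • (2 * Real.pi) with hψ
  have hmem : ∀ i, 0 ≤ ψ i ∧ ψ i < 2 * Real.pi := fun i => by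
    simpa [hψ, Set.mem_Ico] using (hn i).1
  have hcos : ∀ i j, Real.cos (ψ i - ψ j) = Real.cos (φ i - φ j) := fun i j => by
    have : ψ i - ψ j = φ i - φ j + ((n i - n j : ℤ) : ℝ) * (2 * Real.pi) := by
      simp only [hψ, zsmul_eq_mul]; push_cast; ring
    rw [this, Real.cos_add_int_mul_two_pi]
  have hcos0 : ∀ i, Real.cos (ψ i) = Real.cos (φ i - φ 0) := fun i => by
    simp only [hψ, zsmul_eq_mul]
    rw [Real.cos_add_int_mul_two_pi]
  have key : ∀ t : ℝ, |t| ≤ Real.pi / 3 → 1 / 2 ≤ Real.cos t := fun t ht => by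
    rw [← Real.cos_abs, ← Real.cos_pi_div_three]
    exact Real.cos_le_cos_of_nonneg_of_le_pi (abs_nonneg _) (by linarith) ht
  have hlow : ∀ i, i ≠ 0 → Real.pi / 3 < ψ i := fun i hi => by
    by_contra! hle
    have := key (ψ i) (by rw [abs_of_nonneg (hmem i).1]; exact hle)
    rw [hcos0] at this
    linarith [h i 0 hi]
  have hhigh : ∀ i, i ≠ 0 → ψ i < 5 * (Real.pi / 3) := fun i hi => by
    by_contra! hle
    have h2 := hmem i
    have := key (ψ i - 2 * Real.pi) (by rw [abs_le]; constructor <;> linarith)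
    rw [Real.cos_sub_two_pi, hcos0] at this
    linarith [h i 0 hi]
  let F : Fin 5 → Bool × Bool := fun i =>
    (decide (ψ i.succ ≤ Real.pi),
      decide (ψ i.succ ≤ 2 * (Real.pi / 3) ∨ 4 * (Real.pi / 3) ≤ ψ i.succ))
  obtain ⟨i, j, hij, hF⟩ := Fintype.exists_ne_map_eq_of_card_lt F (by simp)
  have hs : i.succ ≠ j.succ := fun h => hij (Fin.succ_injective _ h)
  have hc := h _ _ hs
  rw [← hcos] at hc
  refine absurd (key (ψ i.succ - ψ j.succ) ?_) (not_le.2 hc)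
  have a1 := hlow _ (Fin.succ_ne_zero i)
  have a2 := hlow _ (Fin.succ_ne_zero j)
  have a3 := hhigh _ (Fin.succ_ne_zero i)
  have a4 := hhigh _ (Fin.succ_ne_zero j)
  simp only [F, Prod.mk.injEq, decide_eq_decide] at hF
  obtain ⟨h1, h2⟩ := hF
  rw [abs_le]
  by_cases c1 : ψ i.succ ≤ Real.pi
  · have c1' := h1.1 c1
    by_cases c2 : ψ i.succ ≤ 2 * (Real.pi / 3) ∨ 4 * (Real.pi / 3) ≤ ψ i.succ
    · have c2' := h2.1 c2
      rcases c2 with c2 | c2 <;> rcases c2' with c2' | c2' <;> constructor <;> linarith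
    · have c2' := mt h2.2 c2
      push Not at c2 c2'
      constructor <;> linarith
  · have c1' := mt h1.2 c1
    push Not at c1 c1'
    by_cases c2 : ψ i.succ ≤ 2 * (Real.pi / 3) ∨ 4 * (Real.pi / 3) ≤ ψ i.succ
    · have c2' := h2.1 c2
      rcases c2 with c2 | c2 <;> rcases c2' with c2' | c2' <;> constructor <;> linarith
    · have c2' := mt h2.2 c2
      push Not at c2 c2'
      constructor <;> linarith

lemma dist_eq_norm_complex (x y : Pl) :
    dist x y = ‖(⟨x 0 - y 0, x 1 - y 1⟩ : ℂ)‖ := by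
  rw [EuclideanSpace.dist_eq, Complex.norm_eq_sqrt_sq_add_sq]
  simp [Fin.sum_univ_two, Real.dist_eq, sq_abs]

/-- Among six points other than `c` and at distinct distances from `c`, two are strictly closer to
each other than one of them is to `c`. -/
lemma exists_dist_lt_of_six (c : Pl) (a : Fin 6 → Pl) (hc : ∀ i, a i ≠ c)
    (hne : ∀ i j, i ≠ j → dist c (a i) ≠ dist c (a j)) :
    ∃ i j, i ≠ j ∧ dist (a i) (a j) < dist c (a j) := by
  let z : Fin 6 → ℂ := fun i => ⟨a i 0 - c 0, a i 1 - c 1⟩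
  have hz : ∀ i, dist c (a i) = ‖z i‖ := fun i => by
    rw [dist_comm, dist_eq_norm_complex]
  have hzz : ∀ i j, dist (a i) (a j) = ‖z i - z j‖ := fun i j => by
    rw [dist_eq_norm_complex]; congr 1; apply Complex.ext <;> simp [z]
  obtain ⟨i, j, hij, hcos⟩ := exists_half_le_cos_sub fun i => Complex.arg (z i)
  have hsq : ‖z i - z j‖ ^ 2 =
      ‖z i‖ ^ 2 + ‖z j‖ ^ 2 -
        2 * (‖z i‖ * ‖z j‖ * Real.cos (Complex.arg (z i) - Complex.arg (z j))) := by
    have hi1 := Complex.norm_mul_cos_arg (z i)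
    have hi2 := Complex.norm_mul_sin_arg (z i)
    have hj1 := Complex.norm_mul_cos_arg (z j)
    have hj2 := Complex.norm_mul_sin_arg (z j)
    have e : ‖z i‖ * ‖z j‖ * Real.cos (Complex.arg (z i) - Complex.arg (z j)) =
        (z i).re * (z j).re + (z i).im * (z j).im := by
      rw [Real.cos_sub, ← hi1, ← hi2, ← hj1, ← hj2]; ring
    rw [e, Complex.sq_norm, Complex.sq_norm, Complex.sq_norm, Complex.normSq_apply,
      Complex.normSq_apply, Complex.normSq_apply, Complex.sub_re, Complex.sub_im]
    ring
  have hle : ‖z i - z j‖ ^ 2 ≤ ‖z i‖ ^ 2 + ‖z j‖ ^ 2 - ‖z i‖ * ‖z j‖ := by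
    rw [hsq]
    nlinarith [mul_nonneg (norm_nonneg (z i)) (norm_nonneg (z j))]
  have hd : ‖z i‖ ≠ ‖z j‖ := by rw [← hz, ← hz]; exact hne i j hij
  have hpos : ∀ i, 0 < ‖z i‖ := fun i => by rw [← hz]; exact dist_pos.2 (hc i).symm
  rcases lt_or_gt_of_ne hd with hlt | hlt
  · refine ⟨i, j, hij, ?_⟩
    rw [hzz, hz]
    refine lt_of_pow_lt_pow_left₀ 2 (norm_nonneg _) ?_
    nlinarith [hpos i]
  · refine ⟨j, i, hij.symm, ?_⟩
    rw [dist_comm, hzz, hz]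
    refine lt_of_pow_lt_pow_left₀ 2 (norm_nonneg _) ?_
    nlinarith [hpos j]

/-- Perturbing a single coordinate shows that the configurations with
`dist (x j) (x i) ≠ r x` are generic. -/
lemma isOpen_dense_dist_ne {ι : Type*} [Fintype ι] [DecidableEq ι] {i j : ι} (hij : i ≠ j)
    (r : (ι → Pl) → ℝ) (hr : Continuous r) (hr' : ∀ x y, r (Function.update x j y) = r x) :
    IsOpen {x : ι → Pl | dist (x j) (x i) ≠ r x} ∧ Dense {x : ι → Pl | dist (x j) (x i) ≠ r x} := by
  refine ⟨isOpen_ne_fun (by fun_prop) hr, Metric.dense_iff.2 fun x ε hε => ?_⟩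
  have hd : Dense (Metric.sphere (x i) (r x))ᶜ :=
    interior_eq_empty_iff_dense_compl.1 (interior_sphere' _ _)
  obtain ⟨y, hy, hy'⟩ := Metric.dense_iff.1 hd (x j) ε hε
  refine ⟨Function.update x j y, ?_, ?_⟩
  · rw [Metric.mem_ball, dist_pi_lt_iff hε]
    intro l
    by_cases hl : l = j
    · subst hl; simpa using hy
    · simpa [hl] using hε
  · simpa [hr', hij, dist_eq_norm] using hy'

/-- A finite configuration can be perturbed so that no two points coincide, no point is equidistant
from two others, and no strict inequality between distances is lost. -/
lemma exists_generic_perturbation {ι : Type*} [Finite ι] (p : ι → Pl) :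
    ∃ x : ι → Pl,
      (∀ i j l, j ≠ i → j ≠ l → dist (x i) (x j) ≠ dist (x i) (x l)) ∧
      ∀ i j l m, dist (x i) (x j) ≤ dist (x l) (x m) → dist (p i) (p j) ≤ dist (p l) (p m) := by
  classical
  cases nonempty_fintype ι
  let A : {t : ι × ι × ι // t.2.1 ≠ t.1 ∧ t.2.1 ≠ t.2.2} → Set (ι → Pl) :=
    fun t => {x | dist (x t.1.2.1) (x t.1.1) ≠ dist (x t.1.1) (x t.1.2.2)}
  have hA : ∀ t, IsOpen (A t) ∧ Dense (A t) := fun t =>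
    isOpen_dense_dist_ne t.2.1.symm (fun x => dist (x t.1.1) (x t.1.2.2)) (by fun_prop)
      fun x y => by simp [t.2.1.symm, t.2.2.symm]
  have hdense := dense_iInter_of_isOpen (fun t => (hA t).1) (fun t => (hA t).2)
  have hev : ∀ᶠ x : ι → Pl in nhds p, ∀ i j l m,
      dist (p l) (p m) < dist (p i) (p j) → dist (x l) (x m) < dist (x i) (x j) := by
    simp only [Filter.eventually_all]
    intro i j l m h
    exact ContinuousAt.eventually_lt (by fun_prop) (by fun_prop) h
  obtain ⟨U, hU, hUo, hpU⟩ := eventually_nhds_iff.1 hev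
  obtain ⟨x, hxU, hx⟩ := hdense.inter_open_nonempty U hUo ⟨p, hpU⟩
  refine ⟨x, fun i j l h1 h2 => ?_, fun i j l m h => ?_⟩
  · have := Set.mem_iInter.1 hx ⟨(i, j, l), h1, h2⟩
    rw [dist_comm (x i) (x j)]
    exact this
  · by_contra! hlt
    exact absurd (hU x hxU i j l m hlt) (not_lt.2 h)

namespace SimpleGraph

variable {V : Type*}

/-- Exchanging an edge of a tree for a new edge across the cut it defines gives a tree. -/
lemma IsTree.exchange {T : SimpleGraph V} (hT : T.IsTree) {f : Sym2 V} {x y : V}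
    (hxy : ¬ (T.deleteEdges {f}).Reachable x y) : (T.deleteEdges {f} ⊔ edge x y).IsTree := by
  classical
  have hne : x ≠ y := by rintro rfl; exact hxy (Reachable.refl _)
  induction f with | _ u v
  set F := T.deleteEdges {s(u, v)} with hF
  have hside : ∀ w, F.Reachable w u ∨ F.Reachable w v := by
    intro w
    obtain ⟨p⟩ := hT.connected.preconnected w u
    induction p with
    | nil => exact Or.inl (Reachable.refl _)
    | @cons a b c h p ih =>
      by_cases hab : s(a, b) = s(c, v)
      · rcases Sym2.eq_iff.1 hab with ⟨rfl, -⟩ | ⟨rfl, -⟩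
        · exact Or.inl (Reachable.refl _)
        · exact Or.inr (Reachable.refl _)
      · have hadj : F.Adj a b := by simpa [hF, deleteEdges_adj, h] using hab
        exact (ih hxy hF).imp hadj.reachable.trans hadj.reachable.trans
  have hle : F ≤ F ⊔ edge x y := le_sup_left
  have hnew : (F ⊔ edge x y).Reachable x y :=
    Adj.reachable (Or.inr (by simp [edge_adj, hne]))
  have huv : (F ⊔ edge x y).Reachable u v := by
    rcases hside x with hx | hx <;> rcases hside y with hy | hy
    · exact absurd (hx.trans hy.symm) hxy
    · exact (hx.symm.mono hle).trans (hnew.trans (hy.mono hle))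
    · exact (hy.symm.mono hle).trans (hnew.symm.trans (hx.mono hle))
    · exact absurd (hx.trans hy.symm) hxy
  have hall : ∀ w, (F ⊔ edge x y).Reachable w u := fun w =>
    (hside w).elim (fun h => h.mono hle) fun h => (h.mono hle).trans huv.symm
  have : Nonempty V := ⟨u⟩
  exact ⟨⟨fun a b => (hall a).trans (hall b).symm⟩,
    (hT.isAcyclic.anti (deleteEdges_le _)).sup_edge_of_not_reachable hxy⟩

lemma sum_edgeSet_exchange [Finite V] {M : Type*} [AddCommMonoid M] (W : Sym2 V → M)
    {T : SimpleGraph V} {f : Sym2 V} (hf : f ∈ T.edgeSet) {x y : V}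
    (hxy : ¬ (T.deleteEdges {f}).Reachable x y) :
    ∑ e ∈ (Set.toFinite (T.deleteEdges {f} ⊔ edge x y).edgeSet).toFinset, W e + W f =
      ∑ e ∈ (Set.toFinite T.edgeSet).toFinset, W e + W s(x, y) := by
  classical
  have hne : x ≠ y := by rintro rfl; exact hxy (Reachable.refl _)
  have hnew : s(x, y) ∉ (T.deleteEdges {f}).edgeSet := fun h => hxy (Adj.reachable h)
  have hset : (Set.toFinite (T.deleteEdges {f} ⊔ edge x y).edgeSet).toFinset =
      insert s(x, y) ((Set.toFinite T.edgeSet).toFinset.erase f) := by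
    ext e
    simp [edgeSet_edge_of_ne hne, edgeSet_deleteEdges]
    tauto
  rw [hset, Finset.sum_insert (by simpa [edgeSet_deleteEdges, and_comm] using hnew),
    add_comm (W s(x, y)), add_right_comm,
    Finset.sum_erase_add _ _ (by simpa using hf)]

/-- In a minimum spanning tree, an edge is no heavier than any allowed edge across its cut. -/
lemma IsTree.weight_le_of_not_reachable [Finite V] {M : Type*} [AddCommMonoid M] [LinearOrder M]
    [IsOrderedCancelAddMonoid M] (W : Sym2 V → M) {H T : SimpleGraph V} (hT : T.IsTree)
    (hTH : T ≤ H)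
    (hmin : ∀ T' ≤ H, T'.IsTree → ∑ e ∈ (Set.toFinite T.edgeSet).toFinset, W e ≤
      ∑ e ∈ (Set.toFinite T'.edgeSet).toFinset, W e)
    {f : Sym2 V} (hf : f ∈ T.edgeSet) {x y : V}
    (hxy : ¬ (T.deleteEdges {f}).Reachable x y) (hH : H.Adj x y) : W f ≤ W s(x, y) := by
  have h := hmin _ (sup_le ((deleteEdges_le _).trans hTH) ((edge_le_iff _).2 (Or.inr hH)))
    (hT.exchange hxy)
  have hs := sum_edgeSet_exchange W hf hxy
  by_contra! hlt
  exact absurd hs (ne_of_gt (add_lt_add_of_le_of_lt h hlt))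

lemma IsAcyclic.not_reachable_of_adj {T : SimpleGraph V} (hT : T.IsAcyclic) {c u v : V}
    (hu : T.Adj c u) (hv : T.Adj c v) (huv : u ≠ v) :
    ¬ (T.deleteEdges {s(c, v)}).Reachable u v := by
  intro h
  have hb := isAcyclic_iff_forall_adj_isBridge.1 hT hv
  rw [isBridge_iff] at hb
  refine hb (Reachable.trans (Adj.reachable ?_) h)
  rw [deleteEdges_adj]
  refine ⟨hu, fun h => huv ?_⟩
  have := Sym2.eq_iff.1 (Set.mem_singleton_iff.1 h)
  rcases this with ⟨-, h⟩ | ⟨h1, h2⟩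
  · exact h
  · rw [h2, h1]

lemma IsTree.exists_mem_not_reachable {T : SimpleGraph V} (hT : T.IsTree) {s : Set (Sym2 V)}
    {x y : V} (h : ¬ (T.deleteEdges s).Reachable x y) :
    ∃ f ∈ T.edgeSet, f ∈ s ∧ ¬ (T.deleteEdges {f}).Reachable x y := by
  classical
  obtain ⟨p⟩ := hT.connected.preconnected x y
  obtain ⟨f, hfs, hf⟩ := Walk.exists_mem_edges_of_not_reachable_deleteEdges (p.toPath : T.Walk x y) h
  refine ⟨f, Walk.edges_subset_edgeSet _ hf, hfs, ?_⟩
  rintro ⟨q⟩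
  have heq := (hT.isAcyclic.subsingleton_path x y).elim p.toPath
    ⟨(q.toPath : (T.deleteEdges {f}).Walk x y).mapLe (deleteEdges_le {f}), q.toPath.2.mapLe _⟩
  rw [heq, Walk.edges_mapLe_eq_edges] at hf
  simpa [edgeSet_deleteEdges] using Walk.edges_subset_edgeSet _ hf

end SimpleGraph

/-- The graph on the nodes `V` in which distinct nodes are adjacent iff some of the points they
carry are at distance at most `δ`; the point `p i` is carried by the node `π i`. -/
def nodeGraph {ι V : Type*} (p : ι → Pl) (π : ι → V) (δ : ℝ) : SimpleGraph V where
  Adj u v := u ≠ v ∧ ∃ i j, π i = u ∧ π j = v ∧ dist (p i) (p j) ≤ δ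
  symm := ⟨fun _ _ ⟨h, i, j, hi, hj, hd⟩ => ⟨h.symm, j, i, hj, hi, by rwa [dist_comm]⟩⟩
  loopless := ⟨fun _ h => h.1 rfl⟩

/-- A connected node graph has a spanning tree in which every node carrying a single point has
degree at most five. -/
lemma exists_isTree_degree_le_five {ι V : Type*} [Finite ι] [Finite V] (p : ι → Pl) (π : ι → V)
    (δ : ℝ) (hconn : (nodeGraph p π δ).Connected) :
    ∃ τ ≤ nodeGraph p π δ, τ.IsTree ∧
      ∀ i, (∀ j, π j = π i → j = i) → (τ.neighborSet (π i)).ncard ≤ 5 := by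
  obtain ⟨x, hgen, hord⟩ := exists_generic_perturbation p
  let D : Sym2 V → Set ℝ := fun e =>
    (fun a : ι × ι => dist (x a.1) (x a.2)) '' {a | s(π a.1, π a.2) = e}
  let W : Sym2 V → ℝ := fun e => sInf (D e)
  have hWle : ∀ i j, W s(π i, π j) ≤ dist (x i) (x j) := fun i j =>
    csInf_le (Set.toFinite _).bddBelow ⟨(i, j), rfl, rfl⟩
  obtain ⟨T₀, hT₀, hT₀'⟩ := hconn.exists_isTree_le
  obtain ⟨τ, ⟨hτH, hτ⟩, hmin⟩ := Set.exists_min_image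
    {T | T ≤ nodeGraph p π δ ∧ T.IsTree}
    (fun T => ∑ e ∈ (Set.toFinite T.edgeSet).toFinset, W e) (Set.toFinite _) ⟨T₀, hT₀, hT₀'⟩
  refine ⟨τ, hτH, hτ, fun i hi => ?_⟩
  by_contra! hcard
  have hrep : ∀ u, τ.Adj (π i) u → ∃ j, π j = u ∧ W s(π i, u) = dist (x i) (x j) ∧
      dist (p i) (p j) ≤ δ := by
    intro u hu
    obtain ⟨-, i', j', hi', rfl, hd⟩ := hτH hu
    obtain rfl := hi i' hi'
    have hne : (D s(π i', π j')).Nonempty := ⟨_, (i', j'), rfl, rfl⟩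
    obtain ⟨⟨a, b⟩, hab, hW⟩ := hne.csInf_mem (Set.toFinite _)
    have hfin : ∀ b, dist (x i') (x b) = W s(π i', π j') → dist (p i') (p b) ≤ δ :=
      fun b hb => (hord _ _ _ _ (hb.trans_le (hWle i' j'))).trans hd
    rcases Sym2.eq_iff.1 hab with ⟨h1, h2⟩ | ⟨h1, h2⟩
    · obtain rfl := hi a h1
      exact ⟨b, h2, hW.symm, hfin b hW⟩
    · obtain rfl := hi b h2
      have hW' := (dist_comm _ _).trans hW
      exact ⟨a, h1, hW'.symm, hfin a hW'⟩
  obtain ⟨t, ht, htcard⟩ := Set.exists_subset_card_eq (n := 6) hcard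
  let g : Fin 6 ≃ t := (Finite.equivFinOfCardEq htcard).symm
  have hadj : ∀ n, τ.Adj (π i) (g n) := fun n => ht (g n).2
  choose j hj hjW hjp using fun n => hrep (g n) (hadj n)
  have hjinj : ∀ m n, m ≠ n → j m ≠ j n := fun m n hmn h =>
    hmn (g.injective (Subtype.ext (by rw [← hj m, ← hj n, h])))
  have hji : ∀ n, j n ≠ i := fun n h => (hadj n).ne (by rw [← hj n, h])
  have hxne : ∀ n, x (j n) ≠ x i := fun n h => by
    have := hgen i (j n) i (hji n) (hji n)
    rw [h] at this
    exact this rfl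
  obtain ⟨m, n, hmn, hlt⟩ := exists_dist_lt_of_six (x i) (fun n => x (j n)) hxne
    fun m n hmn => hgen i (j m) (j n) (hji m) (hjinj m n hmn)
  have hgmn : (g m : V) ≠ g n := fun h => hmn (g.injective (Subtype.ext h))
  have hW := hτ.weight_le_of_not_reachable W hτH (fun T' h1 h2 => hmin T' ⟨h1, h2⟩)
    (f := s(π i, (g n : V))) (hadj n)
    (hτ.isAcyclic.not_reachable_of_adj (hadj m) (hadj n) hgmn)
    ⟨hgmn, j m, j n, hj m, hj n, (hord _ _ _ _ hlt.le).trans (hjp n)⟩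
  have h1 := hWle (j m) (j n)
  rw [hj, hj] at h1
  rw [hjW] at hW
  linarith

lemma connAt_range_iff {ι : Type*} (p : ι → Pl) {δ : ℝ} (hδ : 0 ≤ δ) :
    ConnAt (Set.range p) δ ↔ Nonempty ι ∧
      ∀ i j, Relation.ReflTransGen (fun a b => dist (p a) (p b) ≤ δ) i j := by
  rw [ConnAt, SimpleGraph.connected_iff]
  constructor
  · rintro ⟨h, ⟨⟨_, ⟨i₀, -⟩⟩⟩⟩
    refine ⟨⟨i₀⟩, fun i j => ?_⟩
    suffices ∀ a b : Set.range p,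
        (SimpleGraph.fromRel fun x y : Set.range p => dist (x : Pl) (y : Pl) ≤ δ).Reachable a b →
        ∀ i j, p i = a → p j = b →
          Relation.ReflTransGen (fun a b => dist (p a) (p b) ≤ δ) i j from
      this ⟨p i, i, rfl⟩ ⟨p j, j, rfl⟩ (h _ _) i j rfl rfl
    rintro a b ⟨w⟩
    induction w with
    | nil => exact fun i j hi hj => .single (by rw [hi, hj, dist_self]; exact hδ)
    | @cons a c b hac w ih =>
      intro i j hi hj
      obtain ⟨m, hm⟩ := c.2
      refine .head ?_ (ih m j hm hj)
      rw [hi, hm]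
      exact (SimpleGraph.fromRel_adj _ _ _).1 hac |>.2.elim id fun h => by rwa [dist_comm]
  · rintro ⟨⟨i₀⟩, h⟩
    refine ⟨?_, ⟨⟨p i₀, i₀, rfl⟩⟩⟩
    rintro ⟨_, i, rfl⟩ ⟨_, j, rfl⟩
    induction h i j with
    | refl => exact SimpleGraph.Reachable.refl _
    | @tail b c _ hbc ih =>
      refine ih.trans ?_
      by_cases hp : p b = p c
      · simp only [hp]
        exact SimpleGraph.Reachable.refl _
      · exact SimpleGraph.Adj.reachable
          ((SimpleGraph.fromRel_adj _ _ _).2 ⟨fun h => hp (congrArg Subtype.val h), Or.inl hbc⟩)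

lemma nodeGraph_connected {ι V : Type*} {p : ι → Pl} {π : ι → V} (hπ : Function.Surjective π)
    {δ : ℝ} (hδ : 0 ≤ δ) (h : ConnAt (Set.range p) δ) : (nodeGraph p π δ).Connected := by
  obtain ⟨⟨i₀⟩, h⟩ := (connAt_range_iff p hδ).1 h
  have : Nonempty V := ⟨π i₀⟩
  refine ⟨fun u v => ?_⟩
  obtain ⟨i, rfl⟩ := hπ u
  obtain ⟨j, rfl⟩ := hπ v
  induction h i j with
  | refl => exact SimpleGraph.Reachable.refl _
  | @tail b c _ hbc ih =>
    refine ih.trans ?_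
    by_cases hp : π b = π c
    · rw [hp]
    · exact SimpleGraph.Adj.reachable ⟨hp, b, c, rfl, rfl, hbc⟩

lemma connAt_range_of_le_nodeGraph {ι V : Type*} {p : ι → Pl} {π : ι → V} {δ : ℝ} (hδ : 0 ≤ δ)
    [Nonempty ι] {τ : SimpleGraph V} (hτ : τ.Preconnected) (hle : τ ≤ nodeGraph p π δ)
    (hfib : ∀ i j, π i = π j → Relation.ReflTransGen (fun a b => dist (p a) (p b) ≤ δ) i j) :
    ConnAt (Set.range p) δ := by
  refine (connAt_range_iff p hδ).2 ⟨inferInstance, fun i j => ?_⟩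
  suffices ∀ u v, τ.Reachable u v → ∀ i j, π i = u → π j = v →
      Relation.ReflTransGen (fun a b => dist (p a) (p b) ≤ δ) i j from
    this _ _ (hτ _ _) i j rfl rfl
  rintro u v ⟨w⟩
  induction w with
  | nil => exact fun i j hi hj => hfib i j (hi.trans hj.symm)
  | cons h w ih =>
    intro i j hi hj
    obtain ⟨-, a, b, ha, hb, hd⟩ := hle h
    exact (hfib i a (hi.trans ha.symm)).trans (.head hd (ih b j hb hj))

/-- Points at distance at most `δ` lie in the same component of a Euclidean minimum spanning tree
after its edges longer than `δ` are deleted. -/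
lemma reachable_deleteEdges_of_dist_le {P : Finset Pl} {T : SimpleGraph {x // x ∈ P}}
    (hT : T.IsTree)
    (hMST : ∀ T' : SimpleGraph {x // x ∈ P}, T'.IsTree → totalWeight P T ≤ totalWeight P T')
    {δ : ℝ} {x y : {x // x ∈ P}} (hxy : dist (x : Pl) (y : Pl) ≤ δ) :
    (T.deleteEdges {e | δ < edgeDist P e}).Reachable x y := by
  by_contra h
  obtain ⟨f, hf, hfδ, hfxy⟩ := hT.exists_mem_not_reachable h
  have hne : x ≠ y := by rintro rfl; exact h (SimpleGraph.Reachable.refl _)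
  have hW := hT.weight_le_of_not_reachable
    (Sym2.lift ⟨fun (x y : {x // x ∈ P}) => nndist (x : Pl) (y : Pl),
      fun _ _ => nndist_comm _ _⟩) le_top (fun T' _ h => hMST T' h) hf hfxy hne
  induction f with | _ u v
  have hW' : dist (u : Pl) (v : Pl) ≤ dist (x : Pl) (y : Pl) := hW
  exact absurd (hW'.trans hxy) (not_le.2 hfδ)

/-- With `𝒞` the vertex sets of the connected components of a Euclidean MST `T` of `P` after
deleting all edges of length greater than `δ`, there exists a `δ`-realizable topology tree on
`𝒮 ∪ 𝒞` if and only if `δ ≥ δ*`. -/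
theorem stmt6 (k : ℕ) (hk : 1 ≤ k) (s : Fin k → Set Pl)
    (hseg : ∀ i, ∃ a b : Pl, s i = segment ℝ a b)
    (P : Finset Pl) (hP : P.Nonempty)
    (δstar : ℝ)
    (hδstar : IsLeast {δ : ℝ | 0 ≤ δ ∧ ∃ p : Fin k → Pl, (∀ i, p i ∈ s i) ∧
        ConnAt (Set.range p ∪ ↑P) δ} δstar)
    (T : SimpleGraph {x // x ∈ P}) (hT : T.IsTree)
    (hMST : ∀ T' : SimpleGraph {x // x ∈ P}, T'.IsTree → totalWeight P T ≤ totalWeight P T')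
    (δ : ℝ) (hδ : 0 ≤ δ)
    (ℓ : ℕ)
    (e : Fin ℓ ≃ (T.deleteEdges {e | δ < edgeDist P e}).ConnectedComponent)
    (C : Fin ℓ → Set Pl)
    (hC : ∀ i, C i = Subtype.val '' (e i).supp) :
    (∃ τ : SimpleGraph (Fin k ⊕ Fin ℓ), IsTopologyTree τ ∧ Realizable s C δ τ) ↔
      δstar ≤ δ := by
  let F := T.deleteEdges {e | δ < edgeDist P e}
  let π : Fin k ⊕ {x // x ∈ P} → Fin k ⊕ Fin ℓ :=
    Sum.map id fun x => e.symm (F.connectedComponentMk x)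
  have hπ : Function.Surjective π :=
    Function.surjective_id.sumMap
      (e.symm.surjective.comp fun c => c.ind fun x => ⟨x, rfl⟩)
  have hrange : ∀ p : Fin k → Pl,
      Set.range p ∪ ↑P = Set.range (Sum.elim p (Subtype.val : {x // x ∈ P} → Pl)) := fun p => by
    rw [Set.Sum.elim_range, Subtype.range_coe_subtype]; rfl
  have hmemC : ∀ (i : Fin ℓ) (x : {x // x ∈ P}),
      e.symm (F.connectedComponentMk x) = i ↔ (x : Pl) ∈ C i := fun i x => by
    rw [hC, Subtype.val_injective.mem_set_image, SimpleGraph.ConnectedComponent.mem_supp_iff,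
      Equiv.symm_apply_eq]
  constructor
  · rintro ⟨τ, ⟨hτ, -, hCC⟩, p, hps, hSS, hCS⟩
    refine hδstar.2 ⟨hδ, p, hps, ?_⟩
    rw [hrange]
    have : Nonempty (Fin k ⊕ {x // x ∈ P}) := ⟨Sum.inl ⟨0, hk⟩⟩
    refine connAt_range_of_le_nodeGraph (π := π) hδ hτ.connected.preconnected ?_ ?_
    · have hmixed : ∀ i j, τ.Adj (Sum.inr i) (Sum.inl j) →
          (nodeGraph (Sum.elim p Subtype.val) π δ).Adj (Sum.inr i) (Sum.inl j) := fun i j h => by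
        obtain ⟨q, hq, hd⟩ := hCS i j h
        have hqP : q ∈ P := by
          rw [hC] at hq
          obtain ⟨x, -, rfl⟩ := hq
          exact x.2
        exact ⟨h.ne, Sum.inr ⟨q, hqP⟩, Sum.inl j,
          congrArg Sum.inr ((hmemC i ⟨q, hqP⟩).2 hq), rfl, hd⟩
      rintro (i | i) (j | j) h
      · exact ⟨h.ne, Sum.inl i, Sum.inl j, rfl, rfl, hSS i j h⟩
      · exact (hmixed j i h.symm).symm
      · exact hmixed i j h
      · exact absurd h (hCC i j)
    · rintro (i | x) (j | y) h
      · obtain rfl : i = j := Sum.inl_injective h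
        exact .refl
      · cases h
      · cases h
      · have hr : F.Reachable x y :=
          SimpleGraph.ConnectedComponent.exact (e.symm.injective (Sum.inr_injective h))
        rw [SimpleGraph.reachable_iff_reflTransGen] at hr
        refine hr.lift Sum.inr fun a b hab => ?_
        have := (SimpleGraph.deleteEdges_adj.1 hab).2
        exact not_lt.1 this
  · intro hle
    obtain ⟨hδ₀, p, hps, hconn⟩ := hδstar.1
    rw [hrange, connAt_range_iff _ hδ₀] at hconn
    have hconn' := (connAt_range_iff _ hδ).2
      ⟨hconn.1, fun i j => (hconn.2 i j).lift id fun a b h => h.trans hle⟩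
    obtain ⟨τ, hτH, hτ, hdeg⟩ := exists_isTree_degree_le_five _ π δ
      (nodeGraph_connected hπ hδ hconn')
    refine ⟨τ, ⟨hτ, fun i => ?_, fun i j h => ?_⟩, p, hps, fun i j h => ?_, fun i j h => ?_⟩
    · refine hdeg (Sum.inl i) ?_
      rintro (j | x) h
      · exact congrArg Sum.inl (Sum.inl_injective h)
      · cases h
    · obtain ⟨hne, a | x, b | y, ha, hb, hd⟩ := hτH h
      · cases ha
      · cases ha
      · cases hb
      · refine hne ?_
        rw [← ha, ← hb]
        exact congrArg (fun c => Sum.inr (e.symm c)) (SimpleGraph.ConnectedComponent.sound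
          (reachable_deleteEdges_of_dist_le hT hMST hd))
    · obtain ⟨-, a | x, b | y, ha, hb, hd⟩ := hτH h
      · obtain rfl : a = i := Sum.inl_injective ha
        obtain rfl : b = j := Sum.inl_injective hb
        exact hd
      · cases hb
      · cases ha
      · cases ha
    · obtain ⟨-, a | x, b | y, ha, hb, hd⟩ := hτH h
      · cases ha
      · cases ha
      · obtain rfl : b = j := Sum.inl_injective hb
        exact ⟨x, (hmemC i x).1 (Sum.inr_injective ha), hd⟩
      · cases hb

end
end
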